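/- arXiv:2309.08184 — 2 statements merged into one kernel-verified Lean document; each statement's English description precedes it below -/
import Mathlib

section
/- (Motzkin–Straus / Nikiforov quadratic form bound) Let G be a graph with clique number ω and adjacency matrix A_G. For every vector x with nonnegative real entries, xᵀ A_G x ≤ ((ω−1)/ω) (𝟙ᵀ x)², where 𝟙 is the all-ones vector. -/
open Matrix Finset SimpleGraph

variable {V : Type*} [Fintype V] [DecidableEq V]

set_option linter.unusedSectionVars false

lemma adjH (G : SimpleGraph V) [DecidableRel G.Adj] : (G.adjMatrix ℝ).IsHermitian := by
  unfold Matrix.IsHermitian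
  rw [conjTranspose_eq_transpose_of_trivial]
  exact G.transpose_adjMatrix

/-- `graphEig G k` : the (k+1)-st largest eigenvalue (with multiplicity) of the adjacency
matrix of `G`. -/
noncomputable def graphEig (G : SimpleGraph V) [DecidableRel G.Adj] (k : ℕ) : ℝ :=
  ((Finset.univ.val.map (adjH G).eigenvalues).sort (· ≥ ·)).getD k 0

/-- Moving the weight `c` from `u` to a non-adjacent vertex `v` changes the quadratic form
linearly in `c`. -/
lemma adjMatrix_quadForm_shift (G : SimpleGraph V) [DecidableRel G.Adj] (x : V → ℝ) {u v : V}
    (huv : ¬ G.Adj u v) (c : ℝ) :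
    (x + (Pi.single v c - Pi.single u c)) ⬝ᵥ
        (G.adjMatrix ℝ *ᵥ (x + (Pi.single v c - Pi.single u c))) =
      x ⬝ᵥ (G.adjMatrix ℝ *ᵥ x) +
        2 * c * ((G.adjMatrix ℝ *ᵥ x) v - (G.adjMatrix ℝ *ᵥ x) u) := by
  have hvu : ¬ G.Adj v u := fun h => huv h.symm
  have hsymm : ∀ w, x ⬝ᵥ (G.adjMatrix ℝ *ᵥ Pi.single w c) = c * (G.adjMatrix ℝ *ᵥ x) w := by
    intro w
    rw [dotProduct_mulVec, ← mulVec_transpose, transpose_adjMatrix, dotProduct_single, mul_comm]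
  have hdiag : ∀ a b, ¬ G.Adj a b →
      (Pi.single a c : V → ℝ) ⬝ᵥ (G.adjMatrix ℝ *ᵥ Pi.single b c) = 0 := by
    intro a b hab
    simp [single_dotProduct, mulVec_single, adjMatrix_apply, hab]
  simp only [mulVec_add, mulVec_sub, add_dotProduct, sub_dotProduct, dotProduct_add,
    dotProduct_sub, hsymm, hdiag _ _ huv, hdiag _ _ hvu, hdiag _ _ (G.irrefl (v := u)),
    hdiag _ _ (G.irrefl (v := v)), single_dotProduct]
  ring

/-- The Motzkin–Straus bound for a vector whose support is a clique. -/
lemma adjMatrix_quadForm_le_of_isClique_support (G : SimpleGraph V) [DecidableRel G.Adj]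
    (hω : 1 ≤ G.cliqueNum) (x : V → ℝ)
    (hS : G.IsClique (({i | x i ≠ 0} : Finset V) : Set V)) :
    x ⬝ᵥ (G.adjMatrix ℝ *ᵥ x) ≤
      ((G.cliqueNum : ℝ) - 1) / (G.cliqueNum : ℝ) * (∑ i, x i) ^ 2 := by
  have hpos : (0 : ℝ) < G.cliqueNum := by exact_mod_cast hω
  have hform : x ⬝ᵥ (G.adjMatrix ℝ *ᵥ x) = (∑ i, x i) ^ 2 - ∑ i, x i ^ 2 := by
    rw [sq, Finset.sum_mul, ← Finset.sum_sub_distrib]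
    refine Finset.sum_congr rfl fun i _ => ?_
    rw [sq, ← mul_sub]
    by_cases hi : x i = 0
    · simp [hi]
    congr 1
    rw [← Finset.sum_erase_eq_sub (Finset.mem_univ i), mulVec, dotProduct,
      ← Finset.add_sum_erase _ _ (Finset.mem_univ i)]
    simp only [adjMatrix_apply, SimpleGraph.irrefl, if_false, zero_mul, zero_add]
    refine Finset.sum_congr rfl fun j hj => ?_
    by_cases hj0 : x j = 0
    · simp [hj0]
    · rw [if_pos (hS (by simpa using hi) (by simpa using hj0) (Finset.ne_of_mem_erase hj).symm),
        one_mul]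
  have hcs : (∑ i, x i) ^ 2 ≤ G.cliqueNum * ∑ i, x i ^ 2 := by
    have hsum : ∑ i with x i ≠ 0, x i = ∑ i, x i := Finset.sum_filter_ne_zero _
    calc (∑ i, x i) ^ 2
        ≤ #({i | x i ≠ 0} : Finset V) * ∑ i with x i ≠ 0, x i ^ 2 := by
          rw [← hsum]
          exact sq_sum_le_card_mul_sum_sq
      _ ≤ G.cliqueNum * ∑ i, x i ^ 2 := by
          gcongr
          · exact hS.card_le_cliqueNum
          · exact Finset.subset_univ _
  rw [hform, div_mul_eq_mul_div, le_div_iff₀ hpos]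
  linarith

theorem motzkin_straus_nikiforov (G : SimpleGraph V) [DecidableRel G.Adj]
    (hω : 1 ≤ G.cliqueNum) (x : V → ℝ) (hx : ∀ i, 0 ≤ x i) :
    x ⬝ᵥ (G.adjMatrix ℝ *ᵥ x) ≤
      ((G.cliqueNum : ℝ) - 1) / (G.cliqueNum : ℝ) * (∑ i, x i) ^ 2 := by
  induction hn : #({i | x i ≠ 0} : Finset V) using Nat.strong_induction_on generalizing x with
  | _ n ih =>
  by_cases hS : G.IsClique (({i | x i ≠ 0} : Finset V) : Set V)
  · exact adjMatrix_quadForm_le_of_isClique_support G hω x hS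
  obtain ⟨u, v, hu, hv, huv, hadj, hle⟩ : ∃ u v, x u ≠ 0 ∧ x v ≠ 0 ∧ u ≠ v ∧ ¬ G.Adj u v ∧
      (G.adjMatrix ℝ *ᵥ x) u ≤ (G.adjMatrix ℝ *ᵥ x) v := by
    simp only [SimpleGraph.IsClique, Set.Pairwise, Finset.coe_filter, Finset.mem_univ, true_and,
      Set.mem_ofPred_eq, not_forall] at hS
    obtain ⟨u, hu, v, hv, huv, hadj⟩ := hS
    rcases le_total ((G.adjMatrix ℝ *ᵥ x) u) ((G.adjMatrix ℝ *ᵥ x) v) with h | h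
    · exact ⟨u, v, hu, hv, huv, hadj, h⟩
    · exact ⟨v, u, hv, hu, huv.symm, fun h' => hadj h'.symm, h⟩
  set y : V → ℝ := x + (Pi.single v (x u) - Pi.single u (x u)) with hy
  have hyu : y u = 0 := by simp [hy, huv]
  have hyv : y v = x v + x u := by simp [hy, huv.symm]
  have hyw : ∀ w, w ≠ u → w ≠ v → y w = x w := by
    intro w hwu hwv
    simp [hy, hwu, hwv]
  have hy0 : ∀ i, 0 ≤ y i := by
    intro i
    by_cases hiu : i = u
    · rw [hiu, hyu]
    by_cases hiv : i = v
    · rw [hiv, hyv]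
      exact add_nonneg (hx v) (hx u)
    · rw [hyw i hiu hiv]
      exact hx i
  have hcard : #({i | y i ≠ 0} : Finset V) < n := by
    rw [← hn]
    refine Finset.card_lt_card (Finset.ssubset_iff_of_subset ?_ |>.2 ⟨u, by simpa, by simpa⟩)
    intro i hi
    simp only [Finset.mem_filter, Finset.mem_univ, true_and] at hi ⊢
    by_cases hiv : i = v
    · rwa [hiv]
    · rwa [← hyw i (fun h => hi (h ▸ hyu)) hiv]
  have hsum : ∑ i, y i = ∑ i, x i := by
    simp [hy, Finset.sum_add_distrib, Finset.sum_sub_distrib]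
  have hbound := ih _ hcard y hy0 rfl
  rw [hsum, hy, adjMatrix_quadForm_shift G x hadj] at hbound
  nlinarith [mul_nonneg (hx u) (sub_nonneg.2 hle)]
end

section
/- (Equality characterization) Let G be a regular graph with m edges and clique number ω, G ≠ K_ω. Then μ₁(G)² + μ₂(G)² = (2(ω−1)/ω)·m if and only if either G is the Turán graph T(n, ω) with ω dividing n, or G is the disjoint union of two copies of T(n/2, ω) with 2ω dividing n. -/
open Matrix Finset SimpleGraph

variable {V : Type*} [Fintype V] [DecidableEq V]

set_option linter.unusedSectionVars false

lemma adjMatrix_dotProduct_mulVec_comm (G : SimpleGraph V) [DecidableRel G.Adj] (x y : V → ℝ) :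
    x ⬝ᵥ (G.adjMatrix ℝ *ᵥ y) = y ⬝ᵥ (G.adjMatrix ℝ *ᵥ x) := by
  rw [dotProduct_mulVec, ← mulVec_transpose, transpose_adjMatrix, dotProduct_comm]

lemma dotProduct_adjMatrix_mulVec_eq_sum (G : SimpleGraph V) [DecidableRel G.Adj] (x y : V → ℝ) :
    x ⬝ᵥ (G.adjMatrix ℝ *ᵥ y) = ∑ i, ∑ j, G.adjMatrix ℝ i j * (x i * y j) := by
  simp_rw [dotProduct, mulVec, dotProduct, Finset.mul_sum]
  exact Finset.sum_congr rfl fun i _ => Finset.sum_congr rfl fun j _ => by ring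

/-- **Motzkin–Straus inequality**. -/
theorem motzkin_straus (G : SimpleGraph V) [DecidableRel G.Adj] {r : ℕ} (hr : 0 < r)
    (hG : G.CliqueFree (r + 1)) (w : V → ℝ) (hw : ∀ i, 0 ≤ w i) :
    w ⬝ᵥ (G.adjMatrix ℝ *ᵥ w) ≤ (1 - 1 / (r : ℝ)) * (∑ i, w i) ^ 2 := by
  induction hk : #{i | w i ≠ 0} using Nat.strong_induction_on generalizing w with
  | _ k ih =>
  have shift (i j : V) (hij : i ≠ j) (hadj : ¬ G.Adj i j) (hi : w i ≠ 0) (hj : w j ≠ 0)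
      (h : 0 ≤ (Pi.single i 1 - Pi.single j 1 : V → ℝ) ⬝ᵥ (G.adjMatrix ℝ *ᵥ w)) :
      w ⬝ᵥ (G.adjMatrix ℝ *ᵥ w) ≤ (1 - 1 / (r : ℝ)) * (∑ i, w i) ^ 2 := by
    set u : V → ℝ := Pi.single i 1 - Pi.single j 1 with hu
    have huu : u ⬝ᵥ (G.adjMatrix ℝ *ᵥ u) = 0 := by
      simp [hu, mulVec_sub, hadj, G.adj_comm j i]
    have hwu : w ⬝ᵥ (G.adjMatrix ℝ *ᵥ u) = u ⬝ᵥ (G.adjMatrix ℝ *ᵥ w) :=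
      adjMatrix_dotProduct_mulVec_comm G w u
    have hsum : ∑ l, (w + w j • u) l = ∑ l, w l := by
      simp [hu, Finset.sum_add_distrib, ← Finset.mul_sum]
    have key := ih _ ?_ (w + w j • u) ?_ rfl
    · rw [hsum] at key
      refine le_trans ?_ key
      simp only [mulVec_add, mulVec_smul, dotProduct_add, add_dotProduct, dotProduct_smul,
        smul_dotProduct, huu, hwu, smul_eq_mul]
      nlinarith [mul_nonneg (hw j) h]
    · rw [← hk]
      refine Finset.card_lt_card (Finset.ssubset_iff_of_subset ?_ |>.2 ⟨j, ?_, ?_⟩)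
      · intro l
        simp only [mem_filter, mem_univ, true_and]
        contrapose!
        intro hl
        have hli : l ≠ i := by rintro rfl; exact hi hl
        have hlj : l ≠ j := by rintro rfl; exact hj hl
        simp [hu, hl, hli, hlj]
      · simpa using hj
      · simp [hu, hij.symm]
    · intro l
      by_cases hlj : l = j
      · subst hlj; simp [hu, hij.symm]
      · have : 0 ≤ (Pi.single i 1 : V → ℝ) l := by
          rw [Pi.single_apply]; split_ifs <;> norm_num
        simpa [hu, hlj] using add_nonneg (hw l) (mul_nonneg (hw j) this)
  by_cases hcl : ∃ i j, i ≠ j ∧ ¬ G.Adj i j ∧ w i ≠ 0 ∧ w j ≠ 0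
  · obtain ⟨i, j, hij, hadj, hi, hj⟩ := hcl
    rcases le_total 0 ((Pi.single i 1 - Pi.single j 1 : V → ℝ) ⬝ᵥ (G.adjMatrix ℝ *ᵥ w)) with h | h
    · exact shift i j hij hadj hi hj h
    · refine shift j i hij.symm (fun h => hadj h.symm) hj hi ?_
      rw [← neg_sub, neg_dotProduct]
      linarith
  · push Not at hcl
    have hQ : w ⬝ᵥ (G.adjMatrix ℝ *ᵥ w) = (∑ i, w i) ^ 2 - ∑ i, w i ^ 2 := by
      rw [eq_sub_iff_add_eq, sq, Finset.sum_mul, dotProduct, ← Finset.sum_add_distrib]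
      refine Finset.sum_congr rfl fun i _ => ?_
      have : w i ^ 2 = w i * ∑ j, if i = j then w j else 0 := by simp [sq]
      rw [this, ← mul_add, mulVec, dotProduct, ← Finset.sum_add_distrib, Finset.mul_sum,
        Finset.mul_sum]
      refine Finset.sum_congr rfl fun j _ => ?_
      by_cases hij : i = j
      · subst hij; simp
      · by_cases hi : w i = 0
        · simp [hi]
        · by_cases hj : w j = 0
          · simp [hj]
          · have hadj : G.Adj i j := by
              by_contra h
              exact hj (hcl i j hij h hi)
            simp [hij, hadj]
    have hcard : #{i | w i ≠ 0} ≤ r := by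
      by_contra! hlt
      obtain ⟨t, ht, htc⟩ := Finset.exists_subset_card_eq (Nat.succ_le_of_lt hlt)
      refine hG t ⟨fun a ha b hb hab => ?_, htc⟩
      have ha := ht ha
      have hb := ht hb
      simp only [mem_filter, mem_univ, true_and] at ha hb
      by_contra h
      exact hb (hcl a b hab h ha)
    have hS : ∑ i with w i ≠ 0, w i = ∑ i, w i := Finset.sum_filter_ne_zero _
    have hcs := sq_sum_le_card_mul_sum_sq (s := {i | w i ≠ 0}) (f := w)
    rw [hS] at hcs
    have h1 : ∑ i with w i ≠ 0, w i ^ 2 ≤ ∑ i, w i ^ 2 :=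
      Finset.sum_le_sum_of_subset_of_nonneg (Finset.filter_subset _ _) fun _ _ _ => sq_nonneg _
    have h2 : (∑ i, w i) ^ 2 ≤ r * ∑ i, w i ^ 2 := by
      refine hcs.trans (mul_le_mul (by exact_mod_cast hcard) h1 ?_ (by positivity))
      exact Finset.sum_nonneg fun _ _ => sq_nonneg _
    have hr' : (0 : ℝ) < r := by exact_mod_cast hr
    have h3 : (∑ i, w i) ^ 2 / r ≤ ∑ i, w i ^ 2 := by
      rw [div_le_iff₀ hr']; linarith
    rw [hQ]
    have : (1 - 1 / (r : ℝ)) * (∑ i, w i) ^ 2 = (∑ i, w i) ^ 2 - (∑ i, w i) ^ 2 / r := by ring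
    linarith

/-- An orthonormal eigenbasis of the adjacency matrix, with indices of two basis vectors carrying
the two largest eigenvalues. -/
lemma exists_eigenbasis (G : SimpleGraph V) [DecidableRel G.Adj] (hV : 1 < Fintype.card V) :
    ∃ (e : V → V → ℝ) (μ : V → ℝ) (a b : V), a ≠ b ∧ μ a = graphEig G 0 ∧ μ b = graphEig G 1 ∧
      (∀ k, μ k ≤ graphEig G 0) ∧ (∀ k, k ≠ a → μ k ≤ graphEig G 1) ∧
      (∀ k, G.adjMatrix ℝ *ᵥ e k = μ k • e k) ∧
      (∀ k l, e k ⬝ᵥ e l = if k = l then 1 else 0) ∧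
      ∀ x y, x ⬝ᵥ y = ∑ k, (e k ⬝ᵥ x) * (e k ⬝ᵥ y) := by
  set hA := adjH G
  have hsort : (Finset.univ.val.map hA.eigenvalues).sort (· ≥ ·) = List.ofFn hA.eigenvalues₀ := by
    rw [← hA.sort_roots_charpoly_eq_eigenvalues₀, hA.roots_charpoly_eq_eigenvalues]
    simp
  have hk (k : ℕ) (h : k < Fintype.card V) : graphEig G k = hA.eigenvalues₀ ⟨k, h⟩ := by
    rw [graphEig, hsort]
    simp [h]
  let φ : Fin (Fintype.card V) ≃ V := Fintype.equivOfCardEq (Fintype.card_fin _)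
  have hφ (k : Fin (Fintype.card V)) : hA.eigenvalues (φ k) = hA.eigenvalues₀ k := by
    simp [IsHermitian.eigenvalues, φ]
  have hφ' (k : V) : hA.eigenvalues k = hA.eigenvalues₀ (φ.symm k) := rfl
  refine ⟨fun k => hA.eigenvectorBasis k, hA.eigenvalues, φ ⟨0, by omega⟩, φ ⟨1, hV⟩, ?_, ?_, ?_,
    ?_, ?_, ?_, ?_, ?_⟩
  · simp
  · rw [hφ, hk]
  · rw [hφ, hk]
  · intro k
    rw [hk 0 (by omega), hφ']
    exact hA.eigenvalues₀_antitone (Fin.mk_le_of_le_val (Nat.zero_le _))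
  · intro k hka
    rw [hk 1 hV, hφ']
    refine hA.eigenvalues₀_antitone (Fin.mk_le_of_le_val (Nat.one_le_iff_ne_zero.2 fun h => hka ?_))
    rw [← φ.symm_apply_eq]
    exact Fin.ext h
  · exact hA.mulVec_eigenvectorBasis
  · intro k l
    have := orthonormal_iff_ite.1 hA.eigenvectorBasis.orthonormal k l
    rw [← this, EuclideanSpace.inner_eq_star_dotProduct, dotProduct_comm]
    simp
  · intro x y
    have := hA.eigenvectorBasis.sum_inner_mul_inner (WithLp.toLp 2 x) (WithLp.toLp 2 y)
    simp only [EuclideanSpace.inner_eq_star_dotProduct, star_trivial] at this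
    rw [dotProduct_comm, ← this]
    exact Finset.sum_congr rfl fun k _ => by simp only [dotProduct_comm]

lemma two_mul_degree_sub_quadratic_form_eq_sum (G : SimpleGraph V) [DecidableRel G.Adj] {d : ℕ}
    (hreg : G.IsRegularOfDegree d) (x : V → ℝ) :
    2 * (d * (x ⬝ᵥ x) - x ⬝ᵥ (G.adjMatrix ℝ *ᵥ x)) =
      ∑ i, ∑ j, G.adjMatrix ℝ i j * (x i - x j) ^ 2 := by
  have hrow (i : V) : ∑ j, G.adjMatrix ℝ i j = d := by
    have := adjMatrix_mulVec_const_apply_of_regular (α := ℝ) (a := 1) hreg (v := i)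
    simpa [mulVec, dotProduct] using this
  have hcol (j : V) : ∑ i, G.adjMatrix ℝ i j = d := by
    rw [← hrow j]
    exact Finset.sum_congr rfl fun i _ => by simp [G.adj_comm]
  have h1 : ∑ i, ∑ j, G.adjMatrix ℝ i j * x i ^ 2 = d * (x ⬝ᵥ x) := by
    simp_rw [← Finset.sum_mul, hrow, dotProduct, Finset.mul_sum, sq]
  have h2 : ∑ i, ∑ j, G.adjMatrix ℝ i j * x j ^ 2 = d * (x ⬝ᵥ x) := by
    rw [Finset.sum_comm]
    simp_rw [← Finset.sum_mul, hcol, dotProduct, Finset.mul_sum, sq]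
  have h3 : ∑ i, ∑ j, G.adjMatrix ℝ i j * (x i * x j) = x ⬝ᵥ (G.adjMatrix ℝ *ᵥ x) :=
    (dotProduct_adjMatrix_mulVec_eq_sum G x x).symm
  have : ∀ i j, G.adjMatrix ℝ i j * (x i - x j) ^ 2 = G.adjMatrix ℝ i j * x i ^ 2 +
      G.adjMatrix ℝ i j * x j ^ 2 - 2 * (G.adjMatrix ℝ i j * (x i * x j)) := fun i j => by ring
  simp_rw [this, Finset.sum_sub_distrib, Finset.sum_add_distrib, ← Finset.mul_sum, h1, h2, h3]
  ring

lemma adjMatrix_nonneg (G : SimpleGraph V) [DecidableRel G.Adj] (i j : V) :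
    0 ≤ G.adjMatrix ℝ i j := by
  rw [adjMatrix_apply]; split_ifs <;> norm_num

lemma adjMatrix_mulVec_one (G : SimpleGraph V) [DecidableRel G.Adj] {d : ℕ}
    (hreg : G.IsRegularOfDegree d) : G.adjMatrix ℝ *ᵥ 1 = (d : ℝ) • (1 : V → ℝ) := by
  ext i
  have := adjMatrix_mulVec_const_apply_of_regular (α := ℝ) (a := 1) hreg (v := i)
  rw [show (1 : V → ℝ) = Function.const V 1 from rfl, this]
  simp

lemma eigenvalue_le_degree (G : SimpleGraph V) [DecidableRel G.Adj] {d : ℕ}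
    (hreg : G.IsRegularOfDegree d) {x : V → ℝ} (hx : 0 < x ⬝ᵥ x) {μ : ℝ}
    (hμ : G.adjMatrix ℝ *ᵥ x = μ • x) : μ ≤ d := by
  have h := two_mul_degree_sub_quadratic_form_eq_sum G hreg x
  have h0 : 0 ≤ ∑ i, ∑ j, G.adjMatrix ℝ i j * (x i - x j) ^ 2 :=
    Finset.sum_nonneg fun i _ => Finset.sum_nonneg fun j _ =>
      mul_nonneg (adjMatrix_nonneg G i j) (sq_nonneg _)
  rw [hμ, dotProduct_smul, smul_eq_mul] at h
  by_contra! hlt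
  nlinarith

lemma graphEig_zero_of_regular (G : SimpleGraph V) [DecidableRel G.Adj] {d : ℕ}
    (hreg : G.IsRegularOfDegree d) (hV : 1 < Fintype.card V) : graphEig G 0 = d := by
  obtain ⟨e, μ, a, b, -, ha, -, hle, -, heig, horth, hpars⟩ := exists_eigenbasis G hV
  apply le_antisymm
  · rw [← ha]
    exact eigenvalue_le_degree G hreg (by simp [horth]) (heig a)
  · have h1 : (1 : V → ℝ) ⬝ᵥ (G.adjMatrix ℝ *ᵥ 1) = d * ((1 : V → ℝ) ⬝ᵥ 1) := by
      rw [adjMatrix_mulVec_one G hreg, dotProduct_smul, smul_eq_mul]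
    have h2 : (1 : V → ℝ) ⬝ᵥ (G.adjMatrix ℝ *ᵥ 1) ≤ graphEig G 0 * ((1 : V → ℝ) ⬝ᵥ 1) := by
      rw [hpars, hpars, Finset.mul_sum]
      refine Finset.sum_le_sum fun k _ => ?_
      rw [adjMatrix_dotProduct_mulVec_comm, heig, dotProduct_smul, smul_eq_mul,
        dotProduct_comm 1 (e k)]
      nlinarith [hle k, mul_self_nonneg (e k ⬝ᵥ (1 : V → ℝ))]
    have h3 : 0 < (1 : V → ℝ) ⬝ᵥ 1 := by
      simp only [one_dotProduct_one]
      exact_mod_cast (by omega : 0 < Fintype.card V)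
    exact le_of_mul_le_mul_right (h1 ▸ h2) h3

/-- The second eigenvalue dominates any lower bound of the Rayleigh quotient on a plane. -/
lemma le_graphEig_one (G : SimpleGraph V) [DecidableRel G.Adj] (hV : 1 < Fintype.card V) {c : ℝ}
    (x y : V → ℝ) (hxy : LinearIndependent ℝ ![x, y])
    (h : ∀ s t : ℝ, c * ((s • x + t • y) ⬝ᵥ (s • x + t • y)) ≤
      (s • x + t • y) ⬝ᵥ (G.adjMatrix ℝ *ᵥ (s • x + t • y))) :
    c ≤ graphEig G 1 := by
  obtain ⟨e, μ, a, b, -, -, -, -, hle, heig, -, hpars⟩ := exists_eigenbasis G hV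
  obtain ⟨s, t, hst, h0⟩ : ∃ s t : ℝ, s • x + t • y ≠ 0 ∧ e a ⬝ᵥ (s • x + t • y) = 0 := by
    rw [LinearIndependent.pair_iff] at hxy
    by_cases hx : e a ⬝ᵥ x = 0
    · exact ⟨1, 0, fun h => one_ne_zero (hxy _ _ h).1, by simp [hx]⟩
    · refine ⟨e a ⬝ᵥ y, -(e a ⬝ᵥ x), fun h => hx (neg_eq_zero.1 (hxy _ _ h).2), ?_⟩
      simp only [dotProduct_add, dotProduct_smul, smul_eq_mul]
      ring
  have key := h s t
  generalize s • x + t • y = z at hst h0 key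
  have h2 : z ⬝ᵥ (G.adjMatrix ℝ *ᵥ z) ≤ graphEig G 1 * (z ⬝ᵥ z) := by
    rw [hpars, hpars z z, Finset.mul_sum]
    refine Finset.sum_le_sum fun k _ => ?_
    rw [adjMatrix_dotProduct_mulVec_comm, heig, dotProduct_smul, smul_eq_mul, dotProduct_comm z]
    by_cases hk : k = a
    · simp [hk, h0]
    · nlinarith [hle k hk, mul_self_nonneg (e k ⬝ᵥ z)]
  have h3 : 0 < z ⬝ᵥ z := by
    simpa using dotProduct_star_self_pos_iff.2 hst
  exact le_of_mul_le_mul_right (key.trans h2) h3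

lemma graphEig_one_nonneg (G : SimpleGraph V) [DecidableRel G.Adj] (hG : G ≠ ⊤)
    (hV : 1 < Fintype.card V) : 0 ≤ graphEig G 1 := by
  obtain ⟨i, j, hij, hadj⟩ := ne_top_iff_exists_not_adj.1 hG
  refine le_graphEig_one G hV (Pi.single i 1) (Pi.single j 1) ?_ fun s t => ?_
  · rw [LinearIndependent.pair_iff]
    intro s t h
    have hi := congrFun h i
    have hj := congrFun h j
    simp [hij, hij.symm] at hi hj
    exact ⟨hi, hj⟩
  · simp [mulVec_add, mulVec_smul, hadj, G.adj_comm j i]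

lemma exists_eigenvector_orthogonal_one (G : SimpleGraph V) [DecidableRel G.Adj] {d : ℕ}
    (hreg : G.IsRegularOfDegree d) (hV : 1 < Fintype.card V) :
    ∃ x : V → ℝ, 0 < x ⬝ᵥ x ∧ G.adjMatrix ℝ *ᵥ x = graphEig G 1 • x ∧ ∑ i, x i = 0 := by
  obtain ⟨e, μ, a, b, hab, ha, hb, hle, -, heig, horth, -⟩ := exists_eigenbasis G hV
  rw [graphEig_zero_of_regular G hreg hV] at ha
  simp_rw [← dotProduct_one]
  by_cases hd : graphEig G 1 = d
  · by_cases hb1 : e b ⬝ᵥ 1 = 0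
    · exact ⟨e b, by simp [horth], by rw [heig, hb], hb1⟩
    · refine ⟨(e b ⬝ᵥ 1) • e a - (e a ⬝ᵥ 1) • e b, ?_, ?_, ?_⟩
      · simp only [dotProduct_sub, sub_dotProduct, dotProduct_smul, smul_dotProduct, horth, hab,
          hab.symm, if_true, if_false, smul_eq_mul]
        have := mul_self_pos.2 hb1
        nlinarith [mul_self_nonneg (e a ⬝ᵥ 1)]
      · rw [mulVec_sub, mulVec_smul, mulVec_smul, heig, heig, ha, hb, hd, smul_sub, smul_comm,
          smul_comm (e a ⬝ᵥ 1)]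
      · simp only [sub_dotProduct, smul_dotProduct, smul_eq_mul]
        ring
  · refine ⟨e b, by simp [horth], by rw [heig, hb], ?_⟩
    have h := adjMatrix_dotProduct_mulVec_comm G (e b) 1
    rw [adjMatrix_mulVec_one G hreg, heig, hb, dotProduct_smul, dotProduct_smul,
      dotProduct_comm 1, smul_eq_mul, smul_eq_mul] at h
    have : (graphEig G 1 - d) * (e b ⬝ᵥ 1) = 0 := by linarith
    exact (mul_eq_zero.1 this).resolve_left (sub_ne_zero.2 hd)

/-- The bound on an eigenvalue `μ` with eigenvector orthogonal to the constants, obtained by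
averaging the Motzkin–Straus inequality over the weights `(1 ± √(μ/d) x)²`. -/
lemma eigenvalue_inequality (G : SimpleGraph V) [DecidableRel G.Adj] {d r : ℕ}
    (hreg : G.IsRegularOfDegree d) (hd : 0 < d) (hr : 0 < r) (hG : G.CliqueFree (r + 1))
    {μ : ℝ} (hμ : 0 ≤ μ) {x : V → ℝ} (hx : 0 < x ⬝ᵥ x) (hAx : G.adjMatrix ℝ *ᵥ x = μ • x)
    (hx1 : ∑ i, x i = 0) :
    ((d : ℝ) ^ 2 + μ ^ 2) * (d + μ) ^ 2 + 2 * d * μ ^ 2 * (d - μ) ≤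
      (1 - 1 / (r : ℝ)) * Fintype.card V * d * (d + μ) ^ 2 := by
  set n : ℝ := (Fintype.card V : ℝ) with hn
  have hV : Nonempty V := by
    by_contra h
    rw [not_nonempty_iff] at h
    simp [dotProduct] at hx
  have hn0 : 0 < n := by rw [hn]; exact_mod_cast Fintype.card_pos
  have hd0 : (0 : ℝ) < d := by exact_mod_cast hd
  wlog hxn : x ⬝ᵥ x = n generalizing x
  · refine this (x := Real.sqrt (n / (x ⬝ᵥ x)) • x) ?_ ?_ ?_ ?_
    · simp only [dotProduct_smul, smul_dotProduct, smul_eq_mul]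
      positivity
    · rw [mulVec_smul, hAx, smul_comm]
    · simp [← Finset.mul_sum, hx1]
    · simp only [dotProduct_smul, smul_dotProduct, smul_eq_mul]
      rw [← mul_assoc, Real.mul_self_sqrt (by positivity), div_mul_cancel₀ _ hx.ne']
  obtain ⟨c, hc⟩ : ∃ c : ℝ, μ = c * d := ⟨μ / d, (div_mul_cancel₀ _ hd0.ne').symm⟩
  have hc0 : 0 ≤ c := by
    by_contra! h
    nlinarith
  obtain ⟨s, hs⟩ : ∃ s : ℝ, s * s = c := ⟨√c, Real.mul_self_sqrt hc0⟩
  set q : V → ℝ := fun i => x i ^ 2 with hq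
  have hq1 : ∑ i, q i = n := by
    rw [← hxn, dotProduct]
    exact Finset.sum_congr rfl fun i _ => sq _
  have h11 : (1 : V → ℝ) ⬝ᵥ (G.adjMatrix ℝ *ᵥ 1) = d * n := by
    rw [adjMatrix_mulVec_one G hreg, dotProduct_smul, one_dotProduct_one, smul_eq_mul]
  have hq1' : q ⬝ᵥ (G.adjMatrix ℝ *ᵥ 1) = d * n := by
    rw [adjMatrix_mulVec_one G hreg, dotProduct_smul, dotProduct_one, hq1, smul_eq_mul]
  have h1q : (1 : V → ℝ) ⬝ᵥ (G.adjMatrix ℝ *ᵥ q) = d * n := by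
    rw [adjMatrix_dotProduct_mulVec_comm, hq1']
  have hxx : x ⬝ᵥ (G.adjMatrix ℝ *ᵥ x) = c * d * n := by
    rw [hAx, dotProduct_smul, hxn, smul_eq_mul, hc]
  have hqq : c ^ 2 * d * n ≤ q ⬝ᵥ (G.adjMatrix ℝ *ᵥ q) := by
    have h0 : 0 ≤ ∑ i, ∑ j, G.adjMatrix ℝ i j * (x i * x j - c) ^ 2 :=
      Finset.sum_nonneg fun i _ => Finset.sum_nonneg fun j _ =>
        mul_nonneg (adjMatrix_nonneg G i j) (sq_nonneg _)
    have h1 : ∑ i, ∑ j, G.adjMatrix ℝ i j * (x i * x j - c) ^ 2 =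
        q ⬝ᵥ (G.adjMatrix ℝ *ᵥ q) - 2 * c * (x ⬝ᵥ (G.adjMatrix ℝ *ᵥ x)) +
          c ^ 2 * ((1 : V → ℝ) ⬝ᵥ (G.adjMatrix ℝ *ᵥ 1)) := by
      simp_rw [dotProduct_adjMatrix_mulVec_eq_sum, Finset.mul_sum, ← Finset.sum_sub_distrib,
        ← Finset.sum_add_distrib]
      refine Finset.sum_congr rfl fun i _ => Finset.sum_congr rfl fun j _ => ?_
      simp only [hq, Pi.one_apply]
      ring
    rw [h1, hxx, h11] at h0
    linarith
  have hsum (t : ℝ) : ∑ i, (1 + c • q + t • x : V → ℝ) i = n * (1 + c) := by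
    simp only [Pi.add_apply, Pi.smul_apply, Pi.one_apply, Finset.sum_add_distrib, smul_eq_mul,
      ← Finset.mul_sum, hq1, hx1, Finset.sum_const, Finset.card_univ, nsmul_eq_mul, ← hn]
    ring
  have key1 := motzkin_straus G hr hG (1 + c • q + (2 * s) • x) fun i => by
    have : (1 + c • q + (2 * s) • x : V → ℝ) i = (1 + s * x i) ^ 2 := by
      simp only [Pi.add_apply, Pi.smul_apply, Pi.one_apply, smul_eq_mul, hq, ← hs]
      ring
    rw [this]; positivity
  have key2 := motzkin_straus G hr hG (1 + c • q + (-(2 * s)) • x) fun i => by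
    have : (1 + c • q + (-(2 * s)) • x : V → ℝ) i = (1 - s * x i) ^ 2 := by
      simp only [Pi.add_apply, Pi.smul_apply, Pi.one_apply, smul_eq_mul, hq, ← hs]
      ring
    rw [this]; positivity
  rw [hsum] at key1 key2
  simp only [mulVec_add, mulVec_smul, dotProduct_add, add_dotProduct, dotProduct_smul,
    smul_dotProduct, smul_eq_mul, h11, hq1', h1q, hxx] at key1 key2
  set k : ℝ := 1 - 1 / (r : ℝ)
  set Q := q ⬝ᵥ (G.adjMatrix ℝ *ᵥ q)
  have hsum2 : d * n + 2 * c * d * n + c ^ 2 * Q + 4 * c * (c * d * n) ≤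
      k * (n * (1 + c)) ^ 2 := by
    have : s * s * (c * d * n) = c * (c * d * n) := by rw [hs]
    linarith
  have hfin : (d * (1 + 2 * c + 4 * c ^ 2 + c ^ 4)) * n ≤ (k * n * (1 + c) ^ 2) * n := by
    nlinarith [mul_le_mul_of_nonneg_left hqq (sq_nonneg c)]
  have hfin' := mul_le_mul_of_nonneg_right (le_of_mul_le_mul_right hfin hn0)
    (pow_nonneg hd0.le 3)
  rw [hc]
  linarith

lemma two_mul_mul_card_edgeFinset_le_of_cliqueFree {G : SimpleGraph V} [DecidableRel G.Adj] {r : ℕ}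
    (hG : G.CliqueFree (r + 1)) :
    2 * r * #G.edgeFinset ≤ (r - 1) * Fintype.card V ^ 2 := by
  have h := hG.card_edgeFinset_le
  dsimp only at h
  rw [← card_edgeFinset_turanGraph] at h
  exact (Nat.mul_le_mul_left _ h).trans mul_card_edgeFinset_turanGraph_le

lemma two_mul_card_edgeFinset_of_regular {G : SimpleGraph V} [DecidableRel G.Adj] {d : ℕ}
    (hreg : G.IsRegularOfDegree d) : 2 * #G.edgeFinset = Fintype.card V * d := by
  rw [← sum_degrees_eq_twice_card_edges, Finset.sum_congr rfl fun v _ => hreg v]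
  simp

/-- A regular graph attaining Turán's bound is a Turán graph with equal parts. -/
lemma dvd_and_iso_turanGraph_of_regular (G : SimpleGraph V) [DecidableRel G.Adj] {d r : ℕ}
    (hreg : G.IsRegularOfDegree d) (hr : 0 < r) (hG : G.CliqueFree (r + 1))
    (h : r * d = (r - 1) * Fintype.card V) :
    r ∣ Fintype.card V ∧ Nonempty (G ≃g turanGraph (Fintype.card V) r) := by
  constructor
  · have h' : r * d + Fintype.card V = r * Fintype.card V := by
      obtain ⟨k, rfl⟩ := Nat.exists_eq_succ_of_ne_zero hr.ne'
      rw [h, Nat.succ_sub_one]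
      simp [Nat.succ_mul]
    exact (Nat.dvd_add_right (dvd_mul_right r d)).1 (h' ▸ dvd_mul_right _ _)
  · rw [← isTuranMaximal_iff_nonempty_iso_turanGraph hr]
    refine ⟨hG, fun H _ hH => ?_⟩
    refine Nat.le_of_mul_le_mul_left (c := 2 * r)
      ((two_mul_mul_card_edgeFinset_le_of_cliqueFree hH).trans_eq ?_) (by omega)
    calc (r - 1) * Fintype.card V ^ 2 = Fintype.card V * ((r - 1) * Fintype.card V) := by ring
      _ = r * (2 * #G.edgeFinset) := by
        rw [← h, two_mul_card_edgeFinset_of_regular hreg]; ring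
      _ = 2 * r * #G.edgeFinset := by ring

lemma two_mul_mul_card_edgeFinset_turanGraph {n r : ℕ} (hr : 0 < r) (h : r ∣ n) :
    2 * r * #(turanGraph n r).edgeFinset = (r - 1) * n ^ 2 := by
  obtain ⟨k, rfl⟩ := h
  obtain ⟨t, ht⟩ := (Nat.even_mul_pred_self r).two_dvd
  rw [card_edgeFinset_turanGraph, Nat.mul_mod_right]
  have : ((r * k) ^ 2 - 0 ^ 2) * (r - 1) = 2 * r * (t * k ^ 2) := by
    calc ((r * k) ^ 2 - 0 ^ 2) * (r - 1) = (r * (r - 1)) * (r * k ^ 2) := by simp; ring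
      _ = _ := by rw [ht]; ring
  rw [this, Nat.mul_div_cancel_left _ (by omega)]
  simp only [Nat.choose_zero_succ, add_zero]
  calc 2 * r * (t * k ^ 2) = (2 * t) * (r * k ^ 2) := by ring
    _ = _ := by rw [← ht]; ring

lemma adjMatrix_mulVec_of_edge_const (G : SimpleGraph V) [DecidableRel G.Adj] {d : ℕ}
    (hreg : G.IsRegularOfDegree d) {x : V → ℝ} (hx : ∀ i j, G.Adj i j → x i = x j) :
    G.adjMatrix ℝ *ᵥ x = (d : ℝ) • x := by
  ext i
  rw [adjMatrix_mulVec_apply, Finset.sum_congr rfl fun j hj =>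
    (hx i j ((G.mem_neighborFinset i j).1 hj)).symm]
  simp [hreg i]

lemma degree_le_graphEig_one (G : SimpleGraph V) [DecidableRel G.Adj] {d : ℕ}
    (hreg : G.IsRegularOfDegree d) (C : Finset V) (hC : ∀ i j, G.Adj i j → (i ∈ C ↔ j ∈ C))
    {u v : V} (hu : u ∈ C) (hv : v ∉ C) : d ≤ graphEig G 1 := by
  have hV : 1 < Fintype.card V :=
    Fintype.one_lt_card_iff.2 ⟨u, v, fun h => hv (h ▸ hu)⟩
  refine le_graphEig_one G hV (fun i => if i ∈ C then 1 else 0) (fun i => if i ∈ C then 0 else 1)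
    ?_ fun s t => ?_
  · rw [LinearIndependent.pair_iff]
    intro s t h
    have h1 := congrFun h u
    have h2 := congrFun h v
    simp [hu, hv] at h1 h2
    exact ⟨h1, h2⟩
  · rw [adjMatrix_mulVec_of_edge_const G hreg, dotProduct_smul, smul_eq_mul]
    intro i j hij
    simp [hC i j hij]

/-- A graph without edges between `p` and its complement is the disjoint sum of the two induced
subgraphs. -/
def isoSumInduce (G : SimpleGraph V) (p : V → Prop) [DecidablePred p]
    (hp : ∀ i j, G.Adj i j → (p i ↔ p j)) :
    G ≃g (G.induce {v | p v}).sum (G.induce {v | ¬ p v}) where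
  toEquiv := (Equiv.sumCompl p).symm
  map_rel_iff' := by
    intro i j
    by_cases hi : p i <;> by_cases hj : p j
    · simp [Equiv.sumCompl_symm_apply_of_pos hi, Equiv.sumCompl_symm_apply_of_pos hj]
    · simpa [Equiv.sumCompl_symm_apply_of_pos hi, Equiv.sumCompl_symm_apply_of_neg hj] using
        fun h => hj ((hp i j h).1 hi)
    · simpa [Equiv.sumCompl_symm_apply_of_neg hi, Equiv.sumCompl_symm_apply_of_pos hj] using
        fun h => hi ((hp i j h).2 hj)
    · simp [Equiv.sumCompl_symm_apply_of_neg hi, Equiv.sumCompl_symm_apply_of_neg hj]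

lemma induce_isRegularOfDegree (G : SimpleGraph V) [DecidableRel G.Adj] (p : V → Prop)
    [DecidablePred p] (hp : ∀ i j, G.Adj i j → (p i ↔ p j)) {d : ℕ}
    (hreg : G.IsRegularOfDegree d) :
    (G.induce {v | p v}).IsRegularOfDegree d := by
  rintro ⟨i, hi⟩
  rw [← hreg i]
  refine (degree_induce_of_neighborSet_subset (v := ⟨i, hi⟩) ?_).trans ?_
  · exact fun j hj => (hp i j hj).1 hi
  · congr

lemma mul_degree_le_mul_card (G : SimpleGraph V) [DecidableRel G.Adj] (p : V → Prop)
    [DecidablePred p] (hp : ∀ i j, G.Adj i j → (p i ↔ p j)) {d r : ℕ}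
    (hreg : G.IsRegularOfDegree d) (hG : G.CliqueFree (r + 1)) (hne : ∃ v, p v) :
    r * d ≤ (r - 1) * Fintype.card {v // p v} := by
  have h1 := two_mul_mul_card_edgeFinset_le_of_cliqueFree
    (hG.comap (Embedding.induce {v | p v}).isContained)
  have h2 := two_mul_card_edgeFinset_of_regular (induce_isRegularOfDegree G p hp hreg)
  obtain ⟨v, hv⟩ := hne
  have : 0 < Fintype.card {v // p v} := Fintype.card_pos_iff.2 ⟨⟨v, hv⟩⟩
  change _ ≤ (r - 1) * Fintype.card {v // p v} ^ 2 at h1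
  change _ = Fintype.card {v // p v} * d at h2
  refine Nat.le_of_mul_le_mul_left (c := Fintype.card {v // p v}) ?_ this
  calc _ = r * (Fintype.card {v // p v} * d) := by ring
    _ = 2 * r * #(G.induce {v | p v}).edgeFinset := by rw [← h2]; ring
    _ ≤ _ := h1
    _ = _ := by ring

lemma cliqueNum_pos (G : SimpleGraph V) [Nonempty V] : 0 < G.cliqueNum := by
  have h : G.IsClique ({Classical.arbitrary V} : Finset V) := by simp
  exact h.card_le_cliqueNum

lemma cliqueFree_cliqueNum_succ (G : SimpleGraph V) : G.CliqueFree (G.cliqueNum + 1) := by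
  intro s hs
  have h := hs.isClique.card_le_cliqueNum
  rw [hs.card_eq] at h
  omega

lemma cliqueNum_le_degree_succ (G : SimpleGraph V) [DecidableRel G.Adj] {d : ℕ}
    (hreg : G.IsRegularOfDegree d) : G.cliqueNum ≤ d + 1 := by
  obtain ⟨s, hs⟩ := G.exists_isNClique_cliqueNum
  rw [← hs.card_eq]
  rcases s.eq_empty_or_nonempty with rfl | ⟨v, hv⟩
  · simp
  · rw [← hreg v, ← Finset.card_erase_add_one hv, Nat.add_le_add_iff_right]
    refine Finset.card_le_card fun w hw => ?_
    rw [mem_neighborFinset]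
    exact hs.isClique hv (Finset.mem_of_mem_erase hw) (Finset.ne_of_mem_erase hw).symm

/-- If the degree is an eigenvalue with a nonconstant eigenvector and twice the degree attains
Turán's bound, the graph consists of two copies of a Turán graph. -/
lemma dvd_and_iso_sum_turanGraph (G : SimpleGraph V) [DecidableRel G.Adj] {d r : ℕ}
    (hreg : G.IsRegularOfDegree d) (hd : 0 < d) (hr : 0 < r) (hG : G.CliqueFree (r + 1))
    {x : V → ℝ} (hx : 0 < x ⬝ᵥ x) (hAx : G.adjMatrix ℝ *ᵥ x = (d : ℝ) • x) (hx1 : ∑ i, x i = 0)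
    (h : 2 * (r * d) = (r - 1) * Fintype.card V) :
    2 * r ∣ Fintype.card V ∧ Nonempty (G ≃g (turanGraph (Fintype.card V / 2) r).sum
      (turanGraph (Fintype.card V / 2) r)) := by
  classical
  have hconst (i j : V) (hij : G.Adj i j) : x i = x j := by
    have h0 := two_mul_degree_sub_quadratic_form_eq_sum G hreg x
    rw [hAx, dotProduct_smul, smul_eq_mul, sub_self, mul_zero, eq_comm,
      Finset.sum_eq_zero_iff_of_nonneg fun i _ => Finset.sum_nonneg fun j _ =>
      mul_nonneg (adjMatrix_nonneg G i j) (sq_nonneg _)] at h0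
    have h1 := h0 i (mem_univ i)
    rw [Finset.sum_eq_zero_iff_of_nonneg fun j _ =>
      mul_nonneg (adjMatrix_nonneg G i j) (sq_nonneg _)] at h1
    have h2 := h1 j (mem_univ j)
    simpa [hij, sub_eq_zero] using h2
  have hex : ∃ i, x i ≠ 0 := by
    by_contra! h
    have : x = 0 := funext h
    simp [this] at hx
  obtain ⟨i, hi⟩ := hex
  have hpos : ∃ i, 0 < x i := by
    obtain ⟨j, -, hj⟩ := Finset.exists_pos_of_sum_zero_of_exists_nonzero x hx1 ⟨i, mem_univ i, hi⟩
    exact ⟨j, hj⟩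
  have hneg : ∃ i, ¬ 0 < x i := by
    by_contra! h
    exact (Finset.sum_pos (fun i _ => h i) ⟨i, mem_univ i⟩).ne' hx1
  have hp (i j : V) (hij : G.Adj i j) : 0 < x i ↔ 0 < x j := by rw [hconst i j hij]
  have hp' (i j : V) (hij : G.Adj i j) : ¬ 0 < x i ↔ ¬ 0 < x j := by rw [hconst i j hij]
  have h1 := mul_degree_le_mul_card G (fun i => 0 < x i) hp hreg hG hpos
  have h2 := mul_degree_le_mul_card G (fun i => ¬ 0 < x i) hp' hreg hG hneg
  have hcard : Fintype.card {i // 0 < x i} + Fintype.card {i // ¬ 0 < x i} = Fintype.card V := by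
    rw [← Fintype.card_sum]
    exact Fintype.card_congr (Equiv.sumCompl _)
  rw [← hcard, mul_add] at h
  have e1 : r * d = (r - 1) * Fintype.card {i // 0 < x i} := by omega
  have e2 : r * d = (r - 1) * Fintype.card {i // ¬ 0 < x i} := by omega
  have hr1 : 0 < r - 1 := by
    rcases Nat.eq_zero_or_pos (r - 1) with h | h
    · rw [h, zero_mul] at e1
      exact absurd e1 (Nat.mul_pos hr hd).ne'
    · exact h
  have hcc : Fintype.card {i // 0 < x i} = Fintype.card {i // ¬ 0 < x i} :=
    Nat.eq_of_mul_eq_mul_left hr1 (e1.symm.trans e2)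
  obtain ⟨hdvd, ⟨f⟩⟩ := dvd_and_iso_turanGraph_of_regular _
    (induce_isRegularOfDegree G (fun i => 0 < x i) hp hreg) hr
    (hG.comap (Embedding.induce _).isContained) e1
  obtain ⟨-, ⟨g⟩⟩ := dvd_and_iso_turanGraph_of_regular _
    (induce_isRegularOfDegree G (fun i => ¬ 0 < x i) hp' hreg) hr
    (hG.comap (Embedding.induce _).isContained) e2
  change r ∣ Fintype.card {i // 0 < x i} at hdvd
  change _ ≃g turanGraph (Fintype.card {i // 0 < x i}) r at f
  change _ ≃g turanGraph (Fintype.card {i // ¬ 0 < x i}) r at g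
  rw [← hcc] at hcard g
  rw [← hcard, ← two_mul, Nat.mul_div_cancel_left _ two_pos]
  exact ⟨Nat.mul_dvd_mul_left 2 hdvd, ⟨(isoSumInduce G _ hp).trans (f.sumCongr g)⟩⟩

lemma two_mul_mul_degree_of_iso_sum (G : SimpleGraph V) [DecidableRel G.Adj] [Nonempty V]
    {d r : ℕ} (hreg : G.IsRegularOfDegree d) (hr : 0 < r) (h : 2 * r ∣ Fintype.card V)
    (f : G ≃g (turanGraph (Fintype.card V / 2) r).sum (turanGraph (Fintype.card V / 2) r)) :
    2 * (r * d) = (r - 1) * Fintype.card V := by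
  classical
  obtain ⟨k, hk⟩ := h
  have hk2 : Fintype.card V / 2 = r * k := by
    rw [hk, mul_assoc, Nat.mul_div_cancel_left _ two_pos]
  have hm : #G.edgeFinset = 2 * #(turanGraph (Fintype.card V / 2) r).edgeFinset := by
    rw [f.card_edgeFinset_eq]
    simp only [edgeFinset_card]
    rw [Fintype.card_congr edgeSetSumEquiv, Fintype.card_sum, two_mul]
  have ht := two_mul_mul_card_edgeFinset_turanGraph (n := Fintype.card V / 2) hr
    (hk2 ▸ dvd_mul_right r k)
  have h2 := two_mul_card_edgeFinset_of_regular hreg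
  refine Nat.eq_of_mul_eq_mul_left (Fintype.card_pos (α := V)) ?_
  calc Fintype.card V * (2 * (r * d)) = 2 * r * (Fintype.card V * d) := by ring
    _ = 4 * (2 * r * #(turanGraph (Fintype.card V / 2) r).edgeFinset) := by rw [← h2, hm]; ring
    _ = Fintype.card V * ((r - 1) * Fintype.card V) := by
      rw [ht, hk2, hk]; ring

lemma mul_degree_of_iso (G : SimpleGraph V) [DecidableRel G.Adj] [Nonempty V]
    {d r : ℕ} (hreg : G.IsRegularOfDegree d) (hr : 0 < r) (h : r ∣ Fintype.card V)
    (f : G ≃g turanGraph (Fintype.card V) r) :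
    r * d = (r - 1) * Fintype.card V := by
  have ht := two_mul_mul_card_edgeFinset_turanGraph hr h
  have h2 := two_mul_card_edgeFinset_of_regular hreg
  rw [← f.card_edgeFinset_eq] at ht
  refine Nat.eq_of_mul_eq_mul_left (Fintype.card_pos (α := V)) ?_
  calc Fintype.card V * (r * d) = r * (Fintype.card V * d) := by ring
    _ = 2 * r * #G.edgeFinset := by rw [← h2]; ring
    _ = _ := by rw [ht]; ring

theorem equality_characterization (G : SimpleGraph V) [DecidableRel G.Adj]
    (d : ℕ) (hreg : G.IsRegularOfDegree d) (hG : G ≠ ⊤)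
    (n : ℕ) (hn : Fintype.card V = n) :
    (graphEig G 0) ^ 2 + (graphEig G 1) ^ 2 =
      2 * ((G.cliqueNum : ℝ) - 1) / (G.cliqueNum : ℝ) * G.edgeFinset.card
    ↔ ((G.cliqueNum ∣ n ∧ Nonempty (G ≃g turanGraph n G.cliqueNum)) ∨
       (2 * G.cliqueNum ∣ n ∧
        Nonempty (G ≃g (turanGraph (n / 2) G.cliqueNum).sum
          (turanGraph (n / 2) G.cliqueNum)))) := by
  subst hn
  obtain ⟨u, v, huv, -⟩ := ne_top_iff_exists_not_adj.1 hG
  have hV : 1 < Fintype.card V := Fintype.one_lt_card_iff.2 ⟨u, v, huv⟩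
  have : Nonempty V := ⟨u⟩
  have hr := cliqueNum_pos G
  have hfree := cliqueFree_cliqueNum_succ G
  have hrd := cliqueNum_le_degree_succ G hreg
  have hL := graphEig_one_nonneg G hG hV
  obtain ⟨x, hx, hAx, hx1⟩ := exists_eigenvector_orthogonal_one G hreg hV
  have hLd := eigenvalue_le_degree G hreg hx hAx
  have hineq := fun hd => eigenvalue_inequality G hreg hd hr hfree hL hx hAx hx1
  have hm : (2 : ℝ) * #G.edgeFinset = Fintype.card V * d := by
    exact_mod_cast two_mul_card_edgeFinset_of_regular hreg
  rw [graphEig_zero_of_regular G hreg hV]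
  generalize G.cliqueNum = r at *
  have hr0 : (0 : ℝ) < r := by exact_mod_cast hr
  obtain ⟨κ, hκ⟩ : ∃ κ : ℝ, κ = (1 - 1 / (r : ℝ)) * Fintype.card V := ⟨_, rfl⟩
  have hrκ : r * κ = (r - 1 : ℕ) * Fintype.card V := by
    rw [hκ, Nat.cast_sub hr, Nat.cast_one]
    field_simp
  have hRHS : 2 * ((r : ℝ) - 1) / r * #G.edgeFinset = κ * d := by
    rw [hκ]
    field_simp
    linear_combination ((r : ℝ) - 1) * hm
  have hsingle : r * d = (r - 1) * Fintype.card V ↔ (d : ℝ) = κ := by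
    rw [← mul_right_inj' hr0.ne', hrκ]
    norm_cast
  have hdouble : 2 * (r * d) = (r - 1) * Fintype.card V ↔ 2 * (d : ℝ) = κ := by
    rw [← mul_right_inj' hr0.ne', hrκ, mul_left_comm]
    norm_cast
  rw [← hκ] at hineq
  rw [hRHS]
  rcases Nat.eq_zero_or_pos d with hd | hd
  · have hr1 : r = 1 := by omega
    have hL0 : graphEig G 1 = 0 := le_antisymm (by simpa [hd] using hLd) hL
    refine iff_of_true (by simp [hL0, hd]) (Or.inl ?_)
    exact dvd_and_iso_turanGraph_of_regular G hreg hr hfree (by simp [hr1, hd])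
  have hd0 : (0 : ℝ) < d := by exact_mod_cast hd
  have hineq := hineq hd
  set L := graphEig G 1
  have hpos : 0 < (d + L) ^ 2 := by positivity
  constructor
  · intro heq
    rw [heq] at hineq
    have h0 : L ^ 2 * (d - L) = 0 := by
      refine le_antisymm ?_ (mul_nonneg (sq_nonneg _) (sub_nonneg.2 hLd))
      by_contra! h
      nlinarith
    rcases mul_eq_zero.1 h0 with h | h
    · left
      refine dvd_and_iso_turanGraph_of_regular G hreg hr hfree (hsingle.2 ?_)
      rw [h, add_zero, sq] at heq
      exact mul_right_cancel₀ hd0.ne' heq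
    · right
      have hLd' : L = d := by linarith
      refine dvd_and_iso_sum_turanGraph G hreg hd hr hfree hx (hLd' ▸ hAx) hx1 (hdouble.2 ?_)
      rw [hLd'] at heq
      exact mul_right_cancel₀ hd0.ne' (by linarith)
  · rintro (⟨hdvd, ⟨f⟩⟩ | ⟨hdvd, ⟨f⟩⟩)
    · have hdκ := hsingle.1 (mul_degree_of_iso G hreg hr hdvd f)
      rw [← hdκ] at hineq ⊢
      have h1 : L ^ 2 * (d + L) ^ 2 ≤ 0 := by
        have : 0 ≤ 2 * d * L ^ 2 * (d - L) :=
          mul_nonneg (by positivity) (sub_nonneg.2 hLd)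
        nlinarith
      have h2 : L ^ 2 = 0 := by
        by_contra h
        have : 0 < L ^ 2 := lt_of_le_of_ne (sq_nonneg _) (Ne.symm h)
        have := mul_pos this hpos
        linarith
      rw [h2]; ring
    · have hdκ := hdouble.1 (two_mul_mul_degree_of_iso_sum G hreg hr hdvd f)
      have hhalf : 0 < Fintype.card V / 2 := by omega
      let z : Fin (Fintype.card V / 2) := ⟨0, hhalf⟩
      have hdL : (d : ℝ) ≤ L := by
        refine degree_le_graphEig_one G hreg {w | (f w).isLeft} ?_ (u := f.symm (Sum.inl z))
          (v := f.symm (Sum.inr z)) (by simp) (by simp)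
        intro i j hij
        have := f.map_rel_iff.2 hij
        simp only [mem_filter, mem_univ, true_and]
        cases hi : f i <;> cases hj : f j <;> simp_all
      rw [le_antisymm hLd hdL, ← hdκ]
      ring
end
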